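/- arXiv:2006.02185 — 6 statements merged into one kernel-verified Lean document; each statement's English description precedes it below -/
import Mathlib

section
/- Let n ≥ 0 and let λ = λ_0 + λ_1·p + ⋯ + λ_n·p^n with digits λ_i ∈ {0, …, p−1}, and let t_{(λ)} := t_{λ_n} ∘ ⋯ ∘ t_{λ_0} (an (n+1)-fold composite, so t_{(λ)}([α : β]) = [α − λβ : p^{n+1}β]). Then t_{(λ)}(U_{0,λ}^{(n+1)}) = U_0 and t_{(λ)}(ℙ¹(K) ∖ U_{0,λ}^{(n+1)}) = U_∞^{(1)} (both as equalities of subsets of ℙ¹(K)). -/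
/-! Standard opens of `ℙ¹(K)` for a field `K` with an additive valuation
`v : K → ℤ ∪ {∞}`, and the maps `t_ν([α:β]) = [α − νβ : pβ]`. -/

/-- `[α : β] ∈ U_{0,λ}^{(n)}` iff `v(α − λβ) ≥ n + v(β)`. -/
def U0lam {K : Type*} [Field K] (v : AddValuation K (WithTop ℤ)) (n : ℕ) (lam : ℕ) :
    Set (Projectivization K (K × K)) :=
  {x | ∃ (α β : K) (h : ((α, β) : K × K) ≠ 0),
    x = Projectivization.mk K (α, β) h ∧ (n : WithTop ℤ) + v β ≤ v (α - (lam : K) * β)}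

/-- `U_0^{(n)} = ⋃_{λ=0}^{p^n − 1} U_{0,λ}^{(n)}`. -/
def U0N {K : Type*} [Field K] (p : ℕ) (v : AddValuation K (WithTop ℤ)) (n : ℕ) :
    Set (Projectivization K (K × K)) :=
  {x | ∃ lam < p ^ n, x ∈ U0lam v n lam}

/-- `[α : β] ∈ U_0` iff `v(α − λβ) ≥ v(β)` for some `λ ∈ {0, …, p−1}`. -/
def U0set {K : Type*} [Field K] (p : ℕ) (v : AddValuation K (WithTop ℤ)) :
    Set (Projectivization K (K × K)) :=
  {x | ∃ (α β : K) (h : ((α, β) : K × K) ≠ 0),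
    x = Projectivization.mk K (α, β) h ∧ ∃ lam < p, v β ≤ v (α - (lam : K) * β)}

/-- `[α : β] ∈ U_∞` iff `v(β) ≥ v(α)`. -/
def UinfSet {K : Type*} [Field K] (v : AddValuation K (WithTop ℤ)) :
    Set (Projectivization K (K × K)) :=
  {x | ∃ (α β : K) (h : ((α, β) : K × K) ≠ 0),
    x = Projectivization.mk K (α, β) h ∧ v α ≤ v β}

/-- `[α : β] ∈ U_∞^{(n)}` iff `v(β) ≥ n + v(α)`. -/
def UinfN {K : Type*} [Field K] (v : AddValuation K (WithTop ℤ)) (n : ℕ) :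
    Set (Projectivization K (K × K)) :=
  {x | ∃ (α β : K) (h : ((α, β) : K × K) ≠ 0),
    x = Projectivization.mk K (α, β) h ∧ (n : WithTop ℤ) + v α ≤ v β}

theorem AddValuation.natCast_nonneg {K : Type*} [Field K] (v : AddValuation K (WithTop ℤ))
    (m : ℕ) : 0 ≤ v (m : K) := by
  induction m with
  | zero => simp
  | succ m ih =>
    rw [Nat.cast_succ]
    exact (le_min ih v.map_one.ge).trans (v.map_add _ _)

theorem WithTop.int_add_one_le_of_lt {a b : WithTop ℤ} (h : a < b) : a + 1 ≤ b := by
  lift a to ℤ using h.ne_top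
  induction b with
  | top => exact le_top
  | coe b => exact_mod_cast Int.add_one_le_of_lt (WithTop.coe_lt_coe.1 h)

/-- Membership in `U_{0,λ}^{(n)}` can be tested on any homogeneous coordinates. -/
theorem mk_mem_U0lam_iff {K : Type*} [Field K] {v : AddValuation K (WithTop ℤ)}
    {n lam : ℕ} {α β : K} (h : ((α, β) : K × K) ≠ 0) :
    Projectivization.mk K (α, β) h ∈ U0lam v n lam ↔
      (n : WithTop ℤ) + v β ≤ v (α - (lam : K) * β) := by
  refine ⟨?_, fun hle => ⟨α, β, h, rfl, hle⟩⟩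
  rintro ⟨α', β', h', heq, hle⟩
  obtain ⟨c, hc⟩ := (Projectivization.mk_eq_mk_iff K _ _ h h').1 heq
  obtain ⟨hα, hβ⟩ := Prod.ext_iff.1 hc
  simp only [Prod.smul_mk, Units.smul_def, smul_eq_mul] at hα hβ
  have hsub : α - (lam : K) * β = c * (α' - lam * β') := by rw [← hα, ← hβ]; ring
  rw [hsub, ← hβ, v.map_mul, v.map_mul, add_left_comm]
  gcongr

/-- Coordinates of `α − cβ` and `dβ` do not both vanish when `d ≠ 0`. -/
theorem sub_mul_mul_ne_zero {K : Type*} [Field K] {α β d : K} (c : K) (hd : d ≠ 0)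
    (h : ((α, β) : K × K) ≠ 0) : ((α - c * β, d * β) : K × K) ≠ 0 := by
  intro h0
  obtain ⟨h1, h2⟩ := Prod.mk_eq_zero.1 h0
  obtain rfl : β = 0 := (mul_eq_zero.1 h2).resolve_left hd
  exact h (by simpa using h1)

/-- The composite `t_{λ_{m-1}} ∘ ⋯ ∘ t_{λ_0}` in homogeneous coordinates. -/
theorem foldl_range_mk {K : Type*} [Field K] {p : ℕ} (hp : (p : K) ≠ 0)
    {t : ℕ → Projectivization K (K × K) → Projectivization K (K × K)}
    (ht : ∀ ν < p, ∀ (α β : K) (h0 : ((α, β) : K × K) ≠ 0)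
      (h1 : ((α - (ν : K) * β, (p : K) * β) : K × K) ≠ 0),
      t ν (Projectivization.mk K (α, β) h0) =
        Projectivization.mk K (α - (ν : K) * β, (p : K) * β) h1)
    {lam : ℕ → ℕ} (m : ℕ) (hlam : ∀ i < m, lam i < p) {α β : K}
    (h : ((α, β) : K × K) ≠ 0) :
    (List.range m).foldl (fun y i => t (lam i) y) (Projectivization.mk K (α, β) h) =
      Projectivization.mk K
        (α - ((∑ i ∈ Finset.range m, lam i * p ^ i : ℕ) : K) * β, (p : K) ^ m * β)
        (sub_mul_mul_ne_zero _ (pow_ne_zero m hp) h) := by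
  induction m with
  | zero => simp
  | succ m ih =>
    rw [List.range_succ, List.foldl_append, ih fun i hi => hlam i (hi.trans m.lt_succ_self)]
    simp only [List.foldl_cons, List.foldl_nil]
    rw [ht _ (hlam m m.lt_succ_self) _ _ _ (sub_mul_mul_ne_zero _ hp
      (sub_mul_mul_ne_zero _ (pow_ne_zero m hp) h))]
    congr 2
    · rw [Finset.sum_range_succ]
      push_cast
      ring
    · ring

/-- with `λ = λ_0 + λ_1 p + ⋯ + λ_n p^n` (digits `λ_i ∈ {0,…,p−1}`) and
`t_{(λ)} = t_{λ_n} ∘ ⋯ ∘ t_{λ_0}`, one has `t_{(λ)}(U_{0,λ}^{(n+1)}) = U_0` and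
`t_{(λ)}(ℙ¹(K) ∖ U_{0,λ}^{(n+1)}) = U_∞^{(1)}`. -/
theorem eichler_shimura_stmt1 (p : ℕ) (hp : p.Prime) (K : Type*) [Field K] [CharZero K]
    (v : AddValuation K (WithTop ℤ))
    (hv0 : ∀ x : K, v x = ⊤ ↔ x = 0) (hvp : v (p : K) = 1)
    (t : ℕ → Projectivization K (K × K) → Projectivization K (K × K))
    (ht : ∀ ν < p, ∀ (α β : K) (h0 : ((α, β) : K × K) ≠ 0)
      (h1 : ((α - (ν : K) * β, (p : K) * β) : K × K) ≠ 0),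
      t ν (Projectivization.mk K (α, β) h0) =
        Projectivization.mk K (α - (ν : K) * β, (p : K) * β) h1)
    (n : ℕ) (lam : ℕ → ℕ) (hlam : ∀ i ≤ n, lam i < p) :
    (fun x => (List.range (n + 1)).foldl (fun y i => t (lam i) y) x) ''
        (U0lam v (n + 1) (∑ i ∈ Finset.range (n + 1), lam i * p ^ i)) = U0set p v ∧
    (fun x => (List.range (n + 1)).foldl (fun y i => t (lam i) y) x) ''
        (U0lam v (n + 1) (∑ i ∈ Finset.range (n + 1), lam i * p ^ i))ᶜ = UinfN v 1 := by
  have hp0 : (p : K) ≠ 0 := Nat.cast_ne_zero.2 hp.ne_zero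
  have hlam' : ∀ i < n + 1, lam i < p := fun i hi => hlam i (Nat.lt_succ_iff.1 hi)
  have hfold := fun {α β : K} (h : ((α, β) : K × K) ≠ 0) =>
    foldl_range_mk hp0 ht (n + 1) hlam' h
  set L := ∑ i ∈ Finset.range (n + 1), lam i * p ^ i
  have hpow : v ((p : K) ^ (n + 1)) = ((n + 1 : ℕ) : WithTop ℤ) := by
    rw [v.map_pow, hvp, nsmul_one]
  have hpn : (p : K) ^ (n + 1) ≠ 0 := pow_ne_zero _ hp0
  -- `[p ^ (n + 1) * a + λ * b : b]` is a preimage of `[a : b]`.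
  have hpre : ∀ {a b : K}, ((a, b) : K × K) ≠ 0 →
      (((p : K) ^ (n + 1) * a + L * b, b) : K × K) ≠ 0 := by
    intro a b h h0
    obtain ⟨h1, rfl⟩ := Prod.mk_eq_zero.1 h0
    exact h (by simpa [hp0] using h1)
  have himage : ∀ {a b : K} (h : ((a, b) : K × K) ≠ 0),
      (List.range (n + 1)).foldl (fun y i => t (lam i) y)
        (Projectivization.mk K ((p : K) ^ (n + 1) * a + L * b, b) (hpre h)) =
        Projectivization.mk K (a, b) h := by
    intro a b h
    rw [hfold, Projectivization.mk_eq_mk_iff]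
    refine ⟨Units.mk0 _ hpn, ?_⟩
    simp [Units.smul_def]
  constructor <;> ext x <;> constructor
  · rintro ⟨_, ⟨α, β, h, rfl, hle⟩, rfl⟩
    refine ⟨_, _, _, hfold h, 0, hp.pos, ?_⟩
    rwa [Nat.cast_zero, zero_mul, sub_zero, v.map_mul, hpow]
  · rintro ⟨a, b, h, rfl, l, -, hle⟩
    refine ⟨_, (mk_mem_U0lam_iff (hpre h)).2 ?_, himage h⟩
    rw [add_sub_cancel_right, v.map_mul, hpow]
    gcongr
    have hlb : v b ≤ v ((l : K) * b) := by
      rw [v.map_mul]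
      exact le_add_of_nonneg_left (v.natCast_nonneg l)
    simpa using (le_min hle hlb).trans (v.map_add _ _)
  · rintro ⟨x, hx, rfl⟩
    induction x using Projectivization.ind with | h w h => ?_
    obtain ⟨α, β⟩ := w
    rw [Set.mem_compl_iff, mk_mem_U0lam_iff, not_le] at hx
    refine ⟨_, _, _, hfold h, ?_⟩
    rw [v.map_mul, hpow, add_comm]
    exact_mod_cast WithTop.int_add_one_le_of_lt hx
  · rintro ⟨a, b, h, rfl, hle⟩
    refine ⟨_, fun hmem => h ?_, himage h⟩
    rw [mk_mem_U0lam_iff, add_sub_cancel_right, v.map_mul, hpow,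
      WithTop.add_le_add_iff_left (WithTop.natCast_ne_top _)] at hmem
    have ha : v a = ⊤ := by
      by_contra hne
      have := hle.trans hmem
      lift v a to ℤ using hne with z
      norm_cast at this
      lia
    rw [ha] at hle
    have hb : v b = ⊤ := by simpa using hle
    rw [(hv0 a).1 ha, (hv0 b).1 hb]
    rfl
end

section
/- If x ∈ U_∞ ∖ U_0^{(1)} and ν ∈ {0, …, p−1}, then t_ν(x) ∈ U_∞^{(1)}. -/
theorem WithTop.le_of_lt_one_add {a b : WithTop ℤ} (h : a < 1 + b) : a ≤ b := by
  induction b with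
  | top => exact le_top
  | coe b =>
    induction a with
    | top => exact absurd h not_top_lt
    | coe a =>
      norm_cast at h ⊢
      omega

/-- if `x ∈ U_∞ ∖ U_0^{(1)}` and `ν ∈ {0,…,p−1}`, then `t_ν(x) ∈ U_∞^{(1)}`. -/
theorem eichler_shimura_stmt3 (p : ℕ) (hp : p.Prime) (K : Type*) [Field K] [CharZero K]
    (v : AddValuation K (WithTop ℤ))
    (hv0 : ∀ x : K, v x = ⊤ ↔ x = 0) (hvp : v (p : K) = 1)
    (t : ℕ → Projectivization K (K × K) → Projectivization K (K × K))
    (ht : ∀ ν < p, ∀ (α β : K) (h0 : ((α, β) : K × K) ≠ 0)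
      (h1 : ((α - (ν : K) * β, (p : K) * β) : K × K) ≠ 0),
      t ν (Projectivization.mk K (α, β) h0) =
        Projectivization.mk K (α - (ν : K) * β, (p : K) * β) h1)
    (ν : ℕ) (hν : ν < p) (x : Projectivization K (K × K))
    (hx : x ∈ UinfSet v \ U0N p v 1) :
    t ν x ∈ UinfN v 1 := by
  obtain ⟨⟨α, β, h0, rfl, -⟩, hU⟩ := hx
  have hp0 : (p : K) ≠ 0 := Nat.cast_ne_zero.mpr hp.ne_zero
  have h1 : ((α - (ν : K) * β, (p : K) * β) : K × K) ≠ 0 := by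
    intro h
    obtain ⟨hα, hβ⟩ := Prod.mk_eq_zero.mp h
    obtain rfl : β = 0 := (mul_eq_zero.mp hβ).resolve_left hp0
    exact h0 (by simpa using hα)
  have hlt : v (α - (ν : K) * β) < 1 + v β := by
    by_contra! hle
    exact hU ⟨ν, by simpa using hν, α, β, h0, rfl, by simpa using hle⟩
  refine ⟨_, _, h1, ht ν hν α β h0 h1, ?_⟩
  rw [AddValuation.map_mul, hvp, Nat.cast_one]
  exact add_le_add_right (WithTop.le_of_lt_one_add hlt) 1
end

section
/- Let R be a commutative ring, p ∈ R, and α, γ ∈ R with α·γ = p^r for some r ∈ ℕ. Let T be an R-module and v an R-linear endomorphism of T such that v − α·id_T = α·U' for some R-linear automorphism U' of T. Then: (a) every x ∈ T with v(x) = α·x satisfies p^r·x = 0; (b) the endomorphism v̄ induced by v on T^{tf} has no nonzero vector x̄ with v̄(x̄) = α·x̄. -/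
/-! `p`-power torsion submodule `M^{tors}`, torsion-free quotient `M^{tf} = M ⧸ M^{tors}`,
and the maps induced on `^{tf}` quotients by linear maps. -/

/-- The `p`-power-torsion submodule `M^{tors} = {x ∈ M : p^N • x = 0 for some N}`. -/
def pTors {R : Type*} [CommRing R] (p : R) (M : Type*) [AddCommGroup M] [Module R M] :
    Submodule R M where
  carrier := {x | ∃ N : ℕ, p ^ N • x = 0}
  zero_mem' := ⟨0, smul_zero _⟩
  add_mem' := by
    rintro x y ⟨N, hN⟩ ⟨M', hM⟩
    refine ⟨N + M', ?_⟩
    have hx : p ^ (N + M') • x = 0 := by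
      rw [add_comm, pow_add, mul_smul, hN, smul_zero]
    have hy : p ^ (N + M') • y = 0 := by
      rw [pow_add, mul_smul, hM, smul_zero]
    rw [smul_add, hx, hy, add_zero]
  smul_mem' := by
    rintro r x ⟨N, hN⟩
    exact ⟨N, by rw [smul_comm, hN, smul_zero]⟩

/-- A linear map sends `p`-power torsion to `p`-power torsion. -/
theorem pTors_le_comap {R : Type*} [CommRing R] (p : R) {M N : Type*} [AddCommGroup M]
    [Module R M] [AddCommGroup N] [Module R N] (f : M →ₗ[R] N) :
    pTors p M ≤ (pTors p N).comap f := by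
  rintro x ⟨k, hk⟩
  exact ⟨k, by rw [← map_smul, hk, map_zero]⟩

/-- The map `M^{tf} → N^{tf}` induced by a linear map `f : M → N`. -/
def tfMap {R : Type*} [CommRing R] (p : R) {M N : Type*} [AddCommGroup M] [Module R M]
    [AddCommGroup N] [Module R N] (f : M →ₗ[R] N) :
    (M ⧸ pTors p M) →ₗ[R] N ⧸ pTors p N :=
  Submodule.mapQ _ _ f (pTors_le_comap p f)

/-- If `α γ = p^r` and `v − α·id = α·U'`, then `v x − α x` being killed by `p^N` forces `x` to be
killed by `p^(N + r)`. -/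
theorem pow_add_smul_eq_zero_of_sub_smul {R : Type*} [CommRing R] {p α γ : R} {r : ℕ}
    (hαγ : α * γ = p ^ r) {T : Type*} [AddCommGroup T] [Module R T]
    {v : T →ₗ[R] T} {U' : T ≃ₗ[R] T} (hU : ∀ x : T, v x - α • x = α • U' x)
    {N : ℕ} {x : T} (hx : p ^ N • (v x - α • x) = 0) : p ^ (N + r) • x = 0 := by
  apply U'.injective
  rw [map_smul, map_zero, pow_add, ← hαγ, mul_comm α γ, mul_left_comm, mul_smul, mul_smul,
    ← hU, hx, smul_zero]

/-- if `α γ = p^r` and `v − α·id = α·U'` for an automorphism `U'` of `T`, then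
(a) every `x` with `v x = α x` satisfies `p^r x = 0`, and (b) the endomorphism induced by `v`
on `T^{tf}` has no nonzero eigenvector of eigenvalue `α`. -/
theorem eichler_shimura_stmt8 {R : Type*} [CommRing R] (p α γ : R) (r : ℕ)
    (hαγ : α * γ = p ^ r) (T : Type*) [AddCommGroup T] [Module R T]
    (v : T →ₗ[R] T) (U' : T ≃ₗ[R] T) (hU : ∀ x : T, v x - α • x = α • U' x) :
    (∀ x : T, v x = α • x → p ^ r • x = 0) ∧
    (∀ x : T ⧸ pTors p T, tfMap p v x = α • x → x = 0) := by
  refine ⟨fun x hx => ?_, fun x => ?_⟩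
  · simpa using pow_add_smul_eq_zero_of_sub_smul (N := 0) hαγ hU (x := x) (by simp [hx])
  · induction x using Submodule.Quotient.induction_on with
    | H x =>
      intro hx
      obtain ⟨N, hN⟩ : v x - α • x ∈ pTors p T := (Submodule.Quotient.eq _).1 hx
      exact (Submodule.Quotient.mk_eq_zero _).2
        ⟨N + r, pow_add_smul_eq_zero_of_sub_smul hαγ hU hN⟩
end

section
/- (Bounding the torsion through a four-term exact sequence.) Let R be a commutative ring, p ∈ R, and let A →^β B →^γ C →^δ D be R-linear maps with im(β) = ker(γ) and ker(δ) ⊆ im(γ). Let r, s ∈ ℕ and assume: p^r·B^{tors} = 0, p^r·D^{tors} = 0, and p^s annihilates the p-power torsion of the quotient module B^{tf}/β̄(A^{tf}), where β̄ : A^{tf} → B^{tf} is the map induced by β. Then p^{2r+s}·C^{tors} = 0. -/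
/-- let `A →β B →γ C →δ D` be linear maps with `im β = ker γ` and
`ker δ ⊆ im γ`.  If `p^r` kills `B^{tors}` and `D^{tors}`, and `p^s` kills the `p`-power
torsion of `B^{tf}/β̄(A^{tf})`, then `p^{2r+s}` kills `C^{tors}`. -/
theorem eichler_shimura_stmt9 {R : Type*} [CommRing R] (p : R)
    {A B C D : Type*} [AddCommGroup A] [Module R A] [AddCommGroup B] [Module R B]
    [AddCommGroup C] [Module R C] [AddCommGroup D] [Module R D]
    (β : A →ₗ[R] B) (γ : B →ₗ[R] C) (δ : C →ₗ[R] D)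
    (hβγ : LinearMap.range β = LinearMap.ker γ)
    (hγδ : LinearMap.ker δ ≤ LinearMap.range γ)
    (r s : ℕ)
    (hB : ∀ x ∈ pTors p B, p ^ r • x = 0)
    (hD : ∀ x ∈ pTors p D, p ^ r • x = 0)
    (hQ : ∀ y : (B ⧸ pTors p B) ⧸ LinearMap.range (tfMap p β),
      (∃ N : ℕ, p ^ N • y = 0) → p ^ s • y = 0) :
    ∀ x ∈ pTors p C, p ^ (2 * r + s) • x = 0 := by
  rintro x ⟨N, hN⟩
  have hδ : δ (p ^ r • x) = 0 := by
    rw [map_smul]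
    exact hD _ (pTors_le_comap p δ ⟨N, hN⟩)
  obtain ⟨b, hb⟩ := hγδ hδ
  have hker : p ^ N • b ∈ LinearMap.ker γ := by
    rw [LinearMap.mem_ker, map_smul, hb, smul_comm, hN, smul_zero]
  rw [← hβγ] at hker
  obtain ⟨a, ha⟩ := hker
  have hs := hQ (Submodule.Quotient.mk (Submodule.Quotient.mk b)) ⟨N, by
    rw [← Submodule.Quotient.mk_smul, Submodule.Quotient.mk_eq_zero]
    exact ⟨Submodule.Quotient.mk a, congrArg Submodule.Quotient.mk ha⟩⟩
  rw [← Submodule.Quotient.mk_smul, Submodule.Quotient.mk_eq_zero] at hs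
  obtain ⟨a', ha'⟩ := hs
  obtain ⟨a', rfl⟩ := Submodule.Quotient.mk_surjective _ a'
  have htors : β a' - p ^ s • b ∈ pTors p B := (Submodule.Quotient.eq _).1 ha'
  have hγβ : γ (β a') = 0 := by
    rw [← LinearMap.mem_ker, ← hβγ]
    exact LinearMap.mem_range_self β a'
  have h := congrArg γ (hB _ htors)
  rw [map_smul, map_sub, hγβ, map_smul, hb, zero_sub, smul_neg, map_zero, neg_eq_zero,
    smul_smul, smul_smul] at h
  rwa [show p ^ (2 * r + s) = p ^ r * p ^ s * p ^ r by ring]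
end

section
/- (Killing torsion eigenvectors through an exact sequence — abstract form of part 1 of the Appendix theorem.) Let R be a commutative ring, p ∈ R, α ∈ R. Let A →^β B →^γ C →^δ D be R-linear maps with im(β) = ker(γ) and ker(δ) ⊆ im(γ), and let v denote R-linear endomorphisms of A, B, C, D commuting with β, γ, δ. Assume: (i) there is s ∈ ℕ such that every p-power-torsion element d ∈ D with v(d) = α·d satisfies p^s·d = 0; (ii) on B one has v − α·id_B = α·U' for some R-linear automorphism U' of B; (iii) there is c ∈ ℕ such that every z ∈ A can be written p^c·z = z₁ + (v − α)(w) with z₁, w ∈ A and (v − α)(z₁) = 0. Then every p-power-torsion element x ∈ C with v(x) = α·x satisfies α²·p^{c+s}·x = 0. -/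
/-- killing torsion eigenvectors through an exact sequence (abstract form of
part 1 of the Appendix theorem).  Let `A →β B →γ C →δ D` with `im β = ker γ`,
`ker δ ⊆ im γ`, and compatible endomorphisms `v`.  Assume (i) every `p`-power-torsion
`d ∈ D` with `v d = α d` satisfies `p^s d = 0`; (ii) `v − α·id = α·U'` on `B` for an
automorphism `U'`; (iii) every `z ∈ A` satisfies `p^c z = z₁ + (v − α)(w)` with
`v z₁ = α z₁`.  Then every `p`-power-torsion `x ∈ C` with `v x = α x` satisfies
`α² p^{c+s} x = 0`. -/
theorem eichler_shimura_stmt10 {R : Type*} [CommRing R] (p α : R)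
    {A B C D : Type*} [AddCommGroup A] [Module R A] [AddCommGroup B] [Module R B]
    [AddCommGroup C] [Module R C] [AddCommGroup D] [Module R D]
    (β : A →ₗ[R] B) (γ : B →ₗ[R] C) (δ : C →ₗ[R] D)
    (hβγ : LinearMap.range β = LinearMap.ker γ)
    (hγδ : LinearMap.ker δ ≤ LinearMap.range γ)
    (vA : A →ₗ[R] A) (vB : B →ₗ[R] B) (vC : C →ₗ[R] C) (vD : D →ₗ[R] D)
    (hcommβ : β ∘ₗ vA = vB ∘ₗ β) (hcommγ : γ ∘ₗ vB = vC ∘ₗ γ)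
    (hcommδ : δ ∘ₗ vC = vD ∘ₗ δ)
    (s : ℕ) (hs : ∀ d : D, (∃ N : ℕ, p ^ N • d = 0) → vD d = α • d → p ^ s • d = 0)
    (U' : B ≃ₗ[R] B) (hU : ∀ x : B, vB x - α • x = α • U' x)
    (c : ℕ) (hc : ∀ z : A, ∃ z₁ w : A,
      p ^ c • z = z₁ + (vA w - α • w) ∧ vA z₁ = α • z₁) :
    ∀ x : C, (∃ N : ℕ, p ^ N • x = 0) → vC x = α • x → (α ^ 2 * p ^ (c + s)) • x = 0 := by
  rintro x ⟨N, hN⟩ hx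
  obtain ⟨y, hy⟩ : p ^ s • x ∈ LinearMap.range γ := by
    apply hγδ
    rw [LinearMap.mem_ker, map_smul]
    refine hs (δ x) ⟨N, by rw [← map_smul, hN, map_zero]⟩ ?_
    rw [← LinearMap.comp_apply, ← hcommδ, LinearMap.comp_apply, hx, map_smul]
  obtain ⟨z, hz⟩ : vB y - α • y ∈ LinearMap.range β := by
    rw [hβγ, LinearMap.mem_ker, map_sub, ← LinearMap.comp_apply, hcommγ, LinearMap.comp_apply,
      map_smul, hy, map_smul, hx, smul_comm, sub_self]
  obtain ⟨z₁, w, hzw, hz₁⟩ := hc z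
  have hβ (a : A) : vB (β a) = β (vA a) := (LinearMap.congr_fun hcommβ a).symm
  -- Correcting `p ^ c • y` by `β w` makes its image under `v - α` an eigenvector.
  have hy' : vB (p ^ c • y - β w) - α • (p ^ c • y - β w) = β z₁ := by
    have h := congrArg β hzw
    rw [map_smul, hz, map_add, map_sub, ← hβ, map_smul] at h
    rw [map_sub, map_smul, smul_sub, smul_comm α]
    rw [smul_sub] at h
    linear_combination (norm := module) h
  have hkill : α ^ 2 • (p ^ c • y - β w) = 0 := by
    have h := hU (β z₁)
    rw [hβ, hz₁, map_smul, sub_self, ← hy', hU, map_smul, smul_smul, ← pow_two,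
      ← map_smul, ← map_smul] at h
    exact (map_eq_zero_iff U' U'.injective).1 ((map_eq_zero_iff U' U'.injective).1 h.symm)
  have hγβ : γ (β w) = 0 := by
    rw [← LinearMap.mem_ker, ← hβγ]
    exact LinearMap.mem_range_self β w
  have h := congrArg γ hkill
  rwa [map_smul, map_sub, map_smul, hy, hγβ, sub_zero, map_zero, smul_smul, smul_smul,
    mul_assoc, ← pow_add] at h
end

section
/- (Eigenvector lifting under bounded torsion.) Let R be a commutative ring, p ∈ R, α ∈ R, let T be an R-module with an R-linear endomorphism v, and suppose p^r·T^{tors} = 0 for some r ∈ ℕ. Then for every x̄ ∈ T^{tf} with v̄(x̄) = α·x̄ there exists x ∈ T with v(x) = α·x whose image in T^{tf} is p^r·x̄. -/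
/-- eigenvector lifting under bounded torsion.  If `p^r` kills `T^{tors}`,
then every eigenvector `x̄ ∈ T^{tf}` of the induced endomorphism `v̄` with eigenvalue `α`
is, up to the factor `p^r`, the image of an eigenvector `x ∈ T` of `v` with eigenvalue
`α`. -/
theorem eichler_shimura_stmt12 {R : Type*} [CommRing R] (p α : R)
    (T : Type*) [AddCommGroup T] [Module R T] (v : T →ₗ[R] T)
    (r : ℕ) (hT : ∀ x ∈ pTors p T, p ^ r • x = 0) :
    ∀ x : T ⧸ pTors p T, tfMap p v x = α • x →
      ∃ y : T, v y = α • y ∧ Submodule.Quotient.mk y = p ^ r • x := by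
  intro x
  induction x using Submodule.Quotient.induction_on with
  | H t =>
    intro hx
    have hmem : v t - α • t ∈ pTors p T := (Submodule.Quotient.eq _).1 hx
    refine ⟨p ^ r • t, ?_, Submodule.Quotient.mk_smul _ _ _⟩
    have h := hT _ hmem
    rw [smul_sub, sub_eq_zero] at h
    rw [map_smul, h, smul_comm]
end
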